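/- (Galois connection / reflection theorem.) For every Λ$-term M and every λ-term N: M ↠Λ$ N# if and only if M* ↠λ N. Together with the right inverse property N^{#*} ≡ N, this makes the pair (*, #) a reflection of the λ-calculus with βη-reduction into Λ$. -/

import Mathlib

namespace Shift0

/-! ### The calculus Λ$ (de Bruijn representation) -/

/-- Terms of Λ$: variables, λ-abstractions, freeze `$(M)`, application, thaw `S₀(M)`. -/
inductive Tm : Type
  | var : Nat → Tm
  | lam : Tm → Tm
  | freeze : Tm → Tm
  | app : Tm → Tm → Tm
  | thaw : Tm → Tm
  deriving DecidableEq

namespace Tm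

/-- Values of Λ$: variables, abstractions and frozen terms. -/
inductive IsValue : Tm → Prop
  | var (n : Nat) : IsValue (.var n)
  | lam (M : Tm) : IsValue (.lam M)
  | freeze (M : Tm) : IsValue (.freeze M)

/-- Nonvalues of Λ$: applications and thawed terms. -/
inductive IsNonvalue : Tm → Prop
  | app (M N : Tm) : IsNonvalue (.app M N)
  | thaw (M : Tm) : IsNonvalue (.thaw M)

/-- Boolean value test. -/
def isVal : Tm → Bool
  | .var _ => true
  | .lam _ => true
  | .freeze _ => true
  | .app _ _ => false
  | .thaw _ => false

/-- Lift (shift) the free de Bruijn variables `≥ d` up by one. -/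
def lift (d : Nat) : Tm → Tm
  | .var n => if n < d then .var n else .var (n+1)
  | .lam M => .lam (lift (d+1) M)
  | .freeze M => .freeze (lift d M)
  | .app M N => .app (lift d M) (lift d N)
  | .thaw M => .thaw (lift d M)

/-- Capture-avoiding substitution `M[N/x]` (for the de Bruijn variable `x`);
the variables above `x` are shifted down by one. -/
def subst : Tm → Nat → Tm → Tm
  | .var n, x, N => if n = x then N else if n < x then .var n else .var (n-1)
  | .lam M, x, N => .lam (subst M (x+1) (N.lift 0))
  | .freeze M, x, N => .freeze (subst M x N)
  | .app M L, x, N => .app (subst M x N) (subst L x N)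
  | .thaw M, x, N => .thaw (subst M x N)

/-- `M $ N` is sugar for `$(N) M`. -/
def dol (M N : Tm) : Tm := .app (.freeze N) M

/-- `let x = M in N` is sugar for `S₀k.((λx.(k $ N)) $ M)`;
here `N` has the let-bound variable as de Bruijn index `0`. -/
def letIn (M N : Tm) : Tm :=
  .thaw (.lam (dol (.lam (dol (.var 1) (N.lift 1))) (M.lift 0)))

end Tm

/-- Bindable contexts `J ::= [] M | V [] | S₀([])`. -/
inductive JCtx : Type
  | appL : Tm → JCtx
  | appR : Tm → JCtx
  | thaw : JCtx

namespace JCtx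

/-- Well-formedness: in `V []` the term `V` must be a value. -/
def Wf : JCtx → Prop
  | .appL _ => True
  | .appR V => V.IsValue
  | .thaw => True

/-- Plugging a term into a bindable context. -/
def plug : JCtx → Tm → Tm
  | .appL N, M => .app M N
  | .appR V, M => .app V M
  | .thaw, M => .thaw M

/-- Lift the free variables `≥ d` of a bindable context. -/
def lift (d : Nat) : JCtx → JCtx
  | .appL N => .appL (N.lift d)
  | .appR V => .appR (V.lift d)
  | .thaw => .thaw

end JCtx

/-- Pure contexts `K ::= [] | J[K]`, represented as a list of bindable
contexts (head outermost). -/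
abbrev KCtx : Type := List JCtx

/-- Plugging a term into a pure context. -/
def KCtx.plug : KCtx → Tm → Tm
  | [], M => M
  | (J :: K), M => J.plug (KCtx.plug K M)

/-- Well-formedness of a pure context. -/
def KCtx.Wf (K : KCtx) : Prop := ∀ J ∈ K, JCtx.Wf J

/-- Lift the free variables `≥ d` of a pure context. -/
def KCtx.lift (d : Nat) (K : KCtx) : KCtx := K.map (JCtx.lift d)

namespace Tm

/-- The basic contractions of Λ$. -/
inductive Contr : Tm → Tm → Prop
  | betav (M V : Tm) : V.IsValue → Contr (.app (.lam M) V) (M.subst 0 V)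
  | etav (V : Tm) : V.IsValue → Contr (.lam (.app (V.lift 0) (.var 0))) V
  | dolv (V : Tm) : V.IsValue → Contr (.freeze V) (.lam (.app (.var 0) (V.lift 0)))
  | dolsh (V : Tm) : V.IsValue → Contr (.freeze (.thaw V)) V
  | shdol (M : Tm) : Contr (.thaw (.freeze M)) M
  | pure (V : Tm) : V.IsValue → Contr (.thaw (.lam (.app (.var 0) (V.lift 0)))) V
  | bind (J : JCtx) (P : Tm) : J.Wf → P.IsNonvalue →
      Contr (J.plug P) (letIn P ((J.lift 0).plug (.var 0)))

/-- One-step reduction of Λ$: closure of the contractions under arbitrary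
contexts (including under binders). -/
inductive Step : Tm → Tm → Prop
  | contr {M N : Tm} : Contr M N → Step M N
  | lam {M N : Tm} : Step M N → Step (.lam M) (.lam N)
  | freeze {M N : Tm} : Step M N → Step (.freeze M) (.freeze N)
  | appL {M N L : Tm} : Step M N → Step (.app M L) (.app N L)
  | appR {M N L : Tm} : Step M N → Step (.app L M) (.app L N)
  | thaw {M N : Tm} : Step M N → Step (.thaw M) (.thaw N)

/-- Multi-step reduction `↠Λ$`. -/
def Steps : Tm → Tm → Prop := Relation.ReflTransGen Step

/-- Convertibility `=Λ$`: the equivalence generated by reduction. -/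
def Equiv : Tm → Tm → Prop := Relation.EqvGen Step

end Tm

/-! ### The pure λ-calculus with βη -/

/-- Terms of the pure λ-calculus. -/
inductive Lam : Type
  | var : Nat → Lam
  | lam : Lam → Lam
  | app : Lam → Lam → Lam
  deriving DecidableEq

namespace Lam

/-- Lift the free de Bruijn variables `≥ d` up by one. -/
def lift (d : Nat) : Lam → Lam
  | .var n => if n < d then .var n else .var (n+1)
  | .lam M => .lam (lift (d+1) M)
  | .app M N => .app (lift d M) (lift d N)

/-- Capture-avoiding substitution `M[N/x]`. -/
def subst : Lam → Nat → Lam → Lam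
  | .var n, x, N => if n = x then N else if n < x then .var n else .var (n-1)
  | .lam M, x, N => .lam (subst M (x+1) (N.lift 0))
  | .app M L, x, N => .app (subst M x N) (subst L x N)

/-- β and η contractions. -/
inductive Contr : Lam → Lam → Prop
  | beta (M N : Lam) : Contr (.app (.lam M) N) (M.subst 0 N)
  | eta (M : Lam) : Contr (.lam (.app (M.lift 0) (.var 0))) M

/-- One-step βη-reduction, closed under arbitrary contexts. -/
inductive Step : Lam → Lam → Prop
  | contr {M N : Lam} : Contr M N → Step M N
  | lam {M N : Lam} : Step M N → Step (.lam M) (.lam N)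
  | appL {M N L : Lam} : Step M N → Step (.app M L) (.app N L)
  | appR {M N L : Lam} : Step M N → Step (.app L M) (.app L N)

/-- Multi-step βη-reduction `↠λ`. -/
def Steps : Lam → Lam → Prop := Relation.ReflTransGen Step

/-- βη-convertibility `=λ`. -/
def Equiv : Lam → Lam → Prop := Relation.EqvGen Step

end Lam

end Shift0

namespace Shift0

/-! ### The CPS translation `* : Λ$ → λ` and its value part `†` -/

mutual

/-- The CPS translation `M*`.  It is the full unfolding of the equations
`V* = λk.k V†`, `J[P]* = λk.P* (λx.(J[x]* k))`, `(V W)* = V† W†` and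
`(S₀(V))* = V†`. -/
def cps : Tm → Lam
  | .var n => .lam (.app (.var 0) (.var (n+1)))
  | .lam M => .lam (.app (.var 0) ((Lam.lam (cps M)).lift 0))
  | .freeze M => .lam (.app (.var 0) ((cps M).lift 0))
  | .app M N =>
      if M.isVal then
        if N.isVal then .app (cpsV M) (cpsV N)
        else
          .lam (.app ((cps N).lift 0)
            (.lam (.app (.app (((cpsV M).lift 0).lift 0) (.var 0)) (.var 1))))
      else
        if N.isVal then
          .lam (.app ((cps M).lift 0)
            (.lam (.app (.app (.var 0) (((cpsV N).lift 0).lift 0)) (.var 1))))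
        else
          .lam (.app ((cps M).lift 0)
            (.lam (.app
              (.lam (.app ((((cps N).lift 0).lift 0).lift 0)
                (.lam (.app (.app (.var 2) (.var 0)) (.var 1)))))
              (.var 1))))
  | .thaw M =>
      if M.isVal then cpsV M
      else .lam (.app ((cps M).lift 0) (.lam (.app (.var 0) (.var 1))))

/-- The value part `V†` of the CPS translation (junk on nonvalues). -/
def cpsV : Tm → Lam
  | .var n => .var n
  | .lam M => .lam (cps M)
  | .freeze M => cps M
  | .app _ _ => .var 0
  | .thaw _ => .var 0

end

/-! ### The direct-style translation `# : λ → Λ$` and its auxiliary `♮` -/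

namespace Lam

/-- Does the de Bruijn variable `x` occur free in the term? -/
def hasVar (x : Nat) : Lam → Bool
  | .var n => n = x
  | .lam M => hasVar (x+1) M
  | .app M N => hasVar x M || hasVar x N

/-- Shift the free de Bruijn variables `> d` down by one
(inverse of `lift d` on terms not containing `d` free). -/
def lower (d : Nat) : Lam → Lam
  | .var n => if d < n then .var (n-1) else .var n
  | .lam M => .lam (lower (d+1) M)
  | .app M N => .app (lower d M) (lower d N)

/-- Size of a λ-term. -/
def size : Lam → Nat
  | .var _ => 1
  | .lam M => size M + 1
  | .app M N => size M + size N + 1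

theorem size_lower (d : Nat) (M : Lam) : (lower d M).size = M.size := by
  induction M generalizing d with
  | var n => simp only [lower]; split <;> rfl
  | lam M ih => simp [lower, size, ih]
  | app M N ihM ihN => simp [lower, size, ihM, ihN]

end Lam

mutual

/-- The direct-style translation `M#`; the case `(λx.x N)# = N♮` (with
`x ∉ FV(N)`) is rendered by checking that de Bruijn variable `0` does not
occur in `N` and lowering the remaining variables. -/
def ds : Lam → Tm
  | .var n => .thaw (.var n)
  | .app M N => .app (nat M) (nat N)
  | .lam (.app (.var 0) N) =>
      if N.hasVar 0 then .thaw (.lam (.app (.var 0) (nat N)))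
      else nat (N.lower 0)
  | .lam M => .thaw (.lam (ds M))
termination_by M => M.size
decreasing_by all_goals simp [Lam.size, Lam.size_lower] <;> omega

/-- The auxiliary direct-style translation `M♮`. -/
def nat : Lam → Tm
  | .var n => .var n
  | .lam M => .lam (ds M)
  | .app M N => .freeze (.app (nat M) (nat N))
termination_by M => M.size
decreasing_by all_goals simp [Lam.size, Lam.size_lower] <;> omega

end

end Shift0

namespace Shift0

/-! ### Materzok's calculus λ$ -/

/-- Terms of λ$: variables, abstractions, applications, `S₀x.e`
(the body is under a binder) and `e $ e'`. -/
inductive LTm : Type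
  | var : Nat → LTm
  | lam : LTm → LTm
  | app : LTm → LTm → LTm
  | shift : LTm → LTm
  | dollar : LTm → LTm → LTm
  deriving DecidableEq

namespace LTm

/-- Values of λ$: variables and abstractions. -/
inductive IsValue : LTm → Prop
  | var (n : Nat) : IsValue (.var n)
  | lam (e : LTm) : IsValue (.lam e)

/-- Lift the free de Bruijn variables `≥ d` up by one. -/
def lift (d : Nat) : LTm → LTm
  | .var n => if n < d then .var n else .var (n+1)
  | .lam e => .lam (lift (d+1) e)
  | .app e f => .app (lift d e) (lift d f)
  | .shift e => .shift (lift (d+1) e)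
  | .dollar e f => .dollar (lift d e) (lift d f)

/-- Capture-avoiding substitution `e[v/x]`. -/
def subst : LTm → Nat → LTm → LTm
  | .var n, x, N => if n = x then N else if n < x then .var n else .var (n-1)
  | .lam e, x, N => .lam (subst e (x+1) (N.lift 0))
  | .app e f, x, N => .app (subst e x N) (subst f x N)
  | .shift e, x, N => .shift (subst e (x+1) (N.lift 0))
  | .dollar e f, x, N => .dollar (subst e x N) (subst f x N)

end LTm

/-- Pure contexts of λ$: `E ::= [] | E e | v E | E $ e`. -/
inductive ECtx : Type
  | hole : ECtx
  | appL : ECtx → LTm → ECtx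
  | appR : LTm → ECtx → ECtx
  | dolL : ECtx → LTm → ECtx

namespace ECtx

/-- Well-formedness: in `v E` the term `v` must be a value. -/
def Wf : ECtx → Prop
  | .hole => True
  | .appL E _ => E.Wf
  | .appR v E => v.IsValue ∧ E.Wf
  | .dolL E _ => E.Wf

/-- Plugging a term into a pure context of λ$. -/
def plug : ECtx → LTm → LTm
  | .hole, e => e
  | .appL E f, e => .app (E.plug e) f
  | .appR v E, e => .app v (E.plug e)
  | .dolL E f, e => .dollar (E.plug e) f

/-- Lift the free variables `≥ d` of a pure context. -/
def lift (d : Nat) : ECtx → ECtx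
  | .hole => .hole
  | .appL E f => .appL (E.lift d) (f.lift d)
  | .appR v E => .appR (v.lift d) (E.lift d)
  | .dolL E f => .dolL (E.lift d) (f.lift d)

end ECtx

namespace LTm

/-- The axioms of λ$. -/
inductive Ax : LTm → LTm → Prop
  | betav (e v : LTm) : v.IsValue → Ax (.app (.lam e) v) (e.subst 0 v)
  | etav (v : LTm) : v.IsValue → Ax (.lam (.app (v.lift 0) (.var 0))) v
  | dolv (v w : LTm) : v.IsValue → w.IsValue → Ax (.dollar v w) (.app v w)
  | dolE (v : LTm) (E : ECtx) (e : LTm) : v.IsValue → E.Wf →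
      Ax (.dollar v (E.plug e))
         (.dollar (.lam (.dollar (v.lift 0) ((E.lift 0).plug (.var 0)))) e)
  | betad (v e : LTm) : v.IsValue → Ax (.dollar v (.shift e)) (e.subst 0 v)
  | etad (e : LTm) : Ax (.shift (.dollar (.var 0) (e.lift 0))) e

/-- The axioms applied in an arbitrary context. -/
inductive AStep : LTm → LTm → Prop
  | ax {e f : LTm} : Ax e f → AStep e f
  | lam {e f : LTm} : AStep e f → AStep (.lam e) (.lam f)
  | appL {e f g : LTm} : AStep e f → AStep (.app e g) (.app f g)
  | appR {e f g : LTm} : AStep e f → AStep (.app g e) (.app g f)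
  | shift {e f : LTm} : AStep e f → AStep (.shift e) (.shift f)
  | dolL {e f g : LTm} : AStep e f → AStep (.dollar e g) (.dollar f g)
  | dolR {e f g : LTm} : AStep e f → AStep (.dollar g e) (.dollar g f)

/-- The equational theory `=λ$` generated by the axioms. -/
def Equiv : LTm → LTm → Prop := Relation.EqvGen AStep

end LTm

/-- The embedding `ι : λ$ → Λ$`. -/
def iota : LTm → Tm
  | .var n => .var n
  | .lam e => .lam (iota e)
  | .app e f => .app (iota e) (iota f)
  | .shift e => .thaw (.lam (iota e))
  | .dollar e f => .app (.freeze (iota f)) (iota e)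

/-- The translation `π : Λ$ → λ$`. -/
def pi : Tm → LTm
  | .var n => .var n
  | .lam M => .lam (pi M)
  | .freeze M => .lam (.dollar (.var 0) ((pi M).lift 0))
  | .app M N => .app (pi M) (pi N)
  | .thaw M => .app (.lam (.shift (.app (.var 1) (.var 0)))) (pi M)

/-- Materzok's CPS translation `⟦·⟧ : λ$ → λ` (with the value translation
`⟪x⟫ = x`, `⟪λx.e⟫ = λx.⟦e⟧` inlined). -/
def mcps : LTm → Lam
  | .var n => .lam (.app (.var 0) (.var (n+1)))
  | .lam e => .lam (.app (.var 0) ((Lam.lam (mcps e)).lift 0))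
  | .app e f => .lam (.app ((mcps e).lift 0)
      (.lam (.app (((mcps f).lift 0).lift 0)
        (.lam (.app (.app (.var 1) (.var 0)) (.var 2))))))
  | .shift e => .lam (mcps e)
  | .dollar e f => .lam (.app ((mcps e).lift 0)
      (.lam (.app (.app (((mcps f).lift 0).lift 0) (.var 0)) (.var 1))))

end Shift0

namespace Shift0

/-! ### Lifting and substitution in the pure λ-calculus -/

namespace Lam

theorem lift_lift (M : Lam) {d e : Nat} (h : d ≤ e) :
    lift (e + 1) (lift d M) = lift d (lift e M) := by
  induction M generalizing d e with
  | var n => grind [lift]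
  | lam M ih => simp [lift, ih (Nat.succ_le_succ h)]
  | app M N ihM ihN => simp [lift, ihM h, ihN h]

theorem lift_subst_of_le (M N : Lam) {x d : Nat} (h : x ≤ d) :
    lift d (M.subst x N) = (lift (d + 1) M).subst x (lift d N) := by
  induction M generalizing x d N with
  | var n => grind [lift, subst]
  | lam M ih => simp [lift, subst, ih _ (Nat.succ_le_succ h), lift_lift N (Nat.zero_le d)]
  | app M L ihM ihL => simp [lift, subst, ihM _ h, ihL _ h]

theorem lift_subst_of_ge (M N : Lam) {x d : Nat} (h : d ≤ x) :
    lift d (M.subst x N) = (lift d M).subst (x + 1) (lift d N) := by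
  induction M generalizing x d N with
  | var n => grind [lift, subst]
  | lam M ih => simp [lift, subst, ih _ (Nat.succ_le_succ h), lift_lift N (Nat.zero_le d)]
  | app M L ihM ihL => simp [lift, subst, ihM _ h, ihL _ h]

theorem subst_lift_self (M N : Lam) (d : Nat) : (lift d M).subst d N = M := by
  induction M generalizing d N with
  | var n => grind [lift, subst]
  | lam M ih => simp [lift, subst, ih]
  | app M L ihM ihL => simp [lift, subst, ihM, ihL]

theorem exists_lift_of_lift_eq_lift (A M : Lam) {d e : Nat} (h : e ≤ d)
    (heq : lift (d + 1) A = lift e M) : ∃ B, A = lift e B ∧ M = lift d B := by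
  induction A generalizing d e M with
  | var n =>
    cases M with
    | var m => exact ⟨.var (if n < e then n else n - 1), by grind [lift]⟩
    | lam M => grind [lift]
    | app M N => grind [lift]
  | lam A ih =>
    cases M with
    | var m => grind [lift]
    | lam M =>
      simp only [lift, lam.injEq] at heq
      obtain ⟨B, rfl, rfl⟩ := ih M (Nat.succ_le_succ h) heq
      exact ⟨.lam B, rfl, rfl⟩
    | app M N => simp [lift] at heq
  | app A A' ih ih' =>
    cases M with
    | var m => grind [lift]
    | lam M => simp [lift] at heq
    | app M M' =>
      simp only [lift, app.injEq] at heq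
      obtain ⟨B, rfl, rfl⟩ := ih M h heq.1
      obtain ⟨B', rfl, rfl⟩ := ih' M' h heq.2
      exact ⟨.app B B', rfl, rfl⟩

theorem lift_lower {d : Nat} {M : Lam} (h : M.hasVar d = false) : lift d (lower d M) = M := by
  induction M generalizing d with
  | var n => grind [lift, lower, hasVar]
  | lam M ih => simp [lift, lower, ih (d := d + 1) h]
  | app M N ihM ihN =>
    simp only [hasVar, Bool.or_eq_false_iff] at h
    simp [lift, lower, ihM h.1, ihN h.2]

theorem lower_lift (d : Nat) (M : Lam) : lower d (lift d M) = M := by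
  induction M generalizing d with
  | var n => grind [lift, lower]
  | lam M ih => simp [lift, lower, ih]
  | app M N ihM ihN => simp [lift, lower, ihM, ihN]

theorem hasVar_lift (d : Nat) (M : Lam) : (lift d M).hasVar d = false := by
  induction M generalizing d with
  | var n => grind [lift, hasVar]
  | lam M ih => simp [lift, hasVar, ih]
  | app M N ihM ihN => simp [lift, hasVar, ihM, ihN]

theorem size_lift (d : Nat) (M : Lam) : (lift d M).size = M.size := by
  induction M generalizing d with
  | var n => simp only [lift]; split <;> rfl
  | lam M ih => simp [lift, size, ih]
  | app M N ihM ihN => simp [lift, size, ihM, ihN]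

theorem lift_zero_ne_var_zero (M : Lam) : lift 0 M ≠ .var 0 := by
  cases M <;> simp [lift]

theorem lift_eq_var_zero {d : Nat} {M : Lam} (h : lift (d + 1) M = .var 0) : M = .var 0 := by
  cases M <;> grind [lift]

/-! ### βη-reduction -/

theorem Step.lift {M N : Lam} (h : Step M N) (d : Nat) : Step (M.lift d) (N.lift d) := by
  induction h generalizing d with
  | contr h =>
    cases h with
    | beta M N =>
      rw [lift_subst_of_le _ _ (Nat.zero_le d)]
      exact .contr (.beta _ _)
    | eta M =>
      simp only [Lam.lift, lift_lift _ (Nat.zero_le d), Nat.zero_lt_succ, if_true]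
      exact .contr (.eta _)
  | lam _ ih => exact .lam (ih _)
  | appL _ ih => exact .appL (ih _)
  | appR _ ih => exact .appR (ih _)

theorem Step.exists_of_lift {A L : Lam} {d : Nat} (h : Step (A.lift d) L) :
    ∃ B, L = B.lift d ∧ Step A B := by
  generalize hA : A.lift d = A' at h
  induction h generalizing A d with
  | contr h =>
    cases h with
    | beta M N =>
      cases A with
      | var n => grind [Lam.lift]
      | lam A => simp [Lam.lift] at hA
      | app A₁ A₂ =>
        cases A₁ with
        | var n => grind [Lam.lift]
        | app B C => simp [Lam.lift] at hA
        | lam B =>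
          simp only [Lam.lift, app.injEq, lam.injEq] at hA
          obtain ⟨rfl, rfl⟩ := hA
          exact ⟨_, (lift_subst_of_le _ _ (Nat.zero_le d)).symm, .contr (.beta _ _)⟩
    | eta M =>
      cases A with
      | var n => grind [Lam.lift]
      | app A B => simp [Lam.lift] at hA
      | lam A =>
        cases A with
        | var n => grind [Lam.lift]
        | lam A => simp [Lam.lift] at hA
        | app A₁ A₂ =>
          simp only [Lam.lift, app.injEq, lam.injEq] at hA
          obtain ⟨B, rfl, rfl⟩ := exists_lift_of_lift_eq_lift _ _ (Nat.zero_le d) hA.1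
          rw [lift_eq_var_zero hA.2]
          exact ⟨B, rfl, .contr (.eta _)⟩
  | lam _ ih =>
    cases A with
    | var n => grind [Lam.lift]
    | app A B => simp [Lam.lift] at hA
    | lam A =>
      simp only [Lam.lift, lam.injEq] at hA
      obtain ⟨B, rfl, hB⟩ := ih hA
      exact ⟨.lam B, rfl, .lam hB⟩
  | appL _ ih =>
    cases A with
    | var n => grind [Lam.lift]
    | lam A => simp [Lam.lift] at hA
    | app A A' =>
      simp only [Lam.lift, app.injEq] at hA
      obtain ⟨B, rfl, hB⟩ := ih hA.1
      exact ⟨.app B A', by simp [Lam.lift, hA.2], .appL hB⟩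
  | appR _ ih =>
    cases A with
    | var n => grind [Lam.lift]
    | lam A => simp [Lam.lift] at hA
    | app A A' =>
      simp only [Lam.lift, app.injEq] at hA
      obtain ⟨B, rfl, hB⟩ := ih hA.2
      exact ⟨.app A B, by simp [Lam.lift, hA.1], .appR hB⟩

namespace Steps

theorem refl (M : Lam) : Steps M M := Relation.ReflTransGen.refl

theorem of_eq {M N : Lam} (h : M = N) : Steps M N := h ▸ refl M

theorem trans {M N L : Lam} (h : Steps M N) (h' : Steps N L) : Steps M L :=
  Relation.ReflTransGen.trans h h'

theorem beta (M N : Lam) : Steps (.app (.lam M) N) (M.subst 0 N) :=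
  Relation.ReflTransGen.single (.contr (.beta M N))

theorem eta (M : Lam) : Steps (.lam (.app (M.lift 0) (.var 0))) M :=
  Relation.ReflTransGen.single (.contr (.eta M))

theorem lift {M N : Lam} (h : Steps M N) (d : Nat) : Steps (M.lift d) (N.lift d) :=
  Relation.ReflTransGen.lift (Lam.lift d) (fun _ _ h => Step.lift h d) _ _ h

theorem lam {M N : Lam} (h : Steps M N) : Steps (.lam M) (.lam N) :=
  Relation.ReflTransGen.lift Lam.lam (fun _ _ h => Step.lam h) _ _ h

theorem app {M M' N N' : Lam} (h : Steps M M') (h' : Steps N N') :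
    Steps (.app M N) (.app M' N') :=
  Relation.ReflTransGen.trans
    (Relation.ReflTransGen.lift (Lam.app · N) (fun _ _ h => Step.appL h) _ _ h)
    (Relation.ReflTransGen.lift (Lam.app M') (fun _ _ h => Step.appR h) _ _ h')

end Steps

end Lam

/-! ### Values, lifting and reduction in Λ$ -/

namespace Tm

@[simp] theorem isVal_var (n : Nat) : (var n).isVal = true := rfl

@[simp] theorem isVal_lam (M : Tm) : (lam M).isVal = true := rfl

@[simp] theorem isVal_freeze (M : Tm) : (freeze M).isVal = true := rfl

@[simp] theorem isVal_app (M N : Tm) : (app M N).isVal = false := rfl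

@[simp] theorem isVal_thaw (M : Tm) : (thaw M).isVal = false := rfl

theorem isVal_iff {M : Tm} : M.isVal = true ↔ M.IsValue :=
  ⟨fun h => by cases M <;> first | constructor | simp at h, fun h => by cases h <;> rfl⟩

theorem IsNonvalue.isVal_eq_false {M : Tm} (h : M.IsNonvalue) : M.isVal = false := by
  cases h <;> rfl

theorem isNonvalue_of_isVal_eq_false {M : Tm} (h : M.isVal = false) : M.IsNonvalue := by
  cases M <;> first | constructor | simp at h

theorem isVal_lift (d : Nat) (M : Tm) : (M.lift d).isVal = M.isVal := by
  cases M <;> grind [lift, isVal]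

theorem isVal_subst (M : Tm) (x : Nat) {V : Tm} (hV : V.isVal = true) :
    (M.subst x V).isVal = M.isVal := by
  cases M <;> grind [subst, isVal]

theorem subst_lift_self (M N : Tm) (d : Nat) : (lift d M).subst d N = M := by
  induction M generalizing d N with
  | var n => grind [lift, subst]
  | lam M ih => simp [lift, subst, ih]
  | freeze M ih => simp [lift, subst, ih]
  | app M L ihM ihL => simp [lift, subst, ihM, ihL]
  | thaw M ih => simp [lift, subst, ih]

/-- Size of a Λ$-term. -/
def size : Tm → Nat
  | .var _ => 1
  | .lam M => size M + 1
  | .freeze M => size M + 1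
  | .app M N => size M + size N + 1
  | .thaw M => size M + 1

theorem size_lift (d : Nat) (M : Tm) : (lift d M).size = M.size := by
  induction M generalizing d with
  | var n => simp only [lift]; split <;> rfl
  | lam M ih => simp [lift, size, ih]
  | freeze M ih => simp [lift, size, ih]
  | app M N ihM ihN => simp [lift, size, ihM, ihN]
  | thaw M ih => simp [lift, size, ih]

theorem IsNonvalue.one_lt_size {M : Tm} (h : M.IsNonvalue) : 1 < M.size := by
  cases h with
  | app M N => cases M <;> grind [size]
  | thaw M => cases M <;> simp [size]

namespace Steps

theorem refl (M : Tm) : Steps M M := Relation.ReflTransGen.refl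

theorem trans {M N L : Tm} (h : Steps M N) (h' : Steps N L) : Steps M L :=
  Relation.ReflTransGen.trans h h'

theorem contr {M N : Tm} (h : Contr M N) : Steps M N :=
  Relation.ReflTransGen.single (.contr h)

theorem lam {M N : Tm} (h : Steps M N) : Steps (.lam M) (.lam N) :=
  Relation.ReflTransGen.lift Tm.lam (fun _ _ h => Step.lam h) _ _ h

theorem freeze {M N : Tm} (h : Steps M N) : Steps (.freeze M) (.freeze N) :=
  Relation.ReflTransGen.lift Tm.freeze (fun _ _ h => Step.freeze h) _ _ h

theorem thaw {M N : Tm} (h : Steps M N) : Steps (.thaw M) (.thaw N) :=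
  Relation.ReflTransGen.lift Tm.thaw (fun _ _ h => Step.thaw h) _ _ h

theorem app {M M' N N' : Tm} (h : Steps M M') (h' : Steps N N') :
    Steps (.app M N) (.app M' N') :=
  Relation.ReflTransGen.trans
    (Relation.ReflTransGen.lift (Tm.app · N) (fun _ _ h => Step.appL h) _ _ h)
    (Relation.ReflTransGen.lift (Tm.app M') (fun _ _ h => Step.appR h) _ _ h')

end Steps

end Tm

/-! ### The CPS translation -/

theorem cps_of_isVal {V : Tm} (hV : V.isVal = true) :
    cps V = .lam (.app (.var 0) ((cpsV V).lift 0)) := by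
  cases V <;> simp [cps, cpsV, Lam.lift] at *

theorem cps_lift_and_cpsV_lift (M : Tm) (d : Nat) :
    cps (M.lift d) = (cps M).lift d ∧
      (M.isVal = true → cpsV (M.lift d) = (cpsV M).lift d) := by
  induction M generalizing d with
  | var n => simp only [Tm.lift]; split <;> simp [Lam.lift, cps, cpsV, *]
  | lam M ih => simp [Tm.lift, Lam.lift, cps, cpsV, Lam.lift_lift, (ih (d + 1)).1]
  | freeze M ih => simp [Tm.lift, Lam.lift, cps, cpsV, Lam.lift_lift, (ih d).1]
  | app M N ihM ihN =>
    obtain ⟨hM, hM'⟩ := ihM d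
    obtain ⟨hN, hN'⟩ := ihN d
    cases hvM : M.isVal <;> cases hvN : N.isVal <;>
      simp_all [Tm.lift, Lam.lift, cps, Tm.isVal_lift, Lam.lift_lift]
  | thaw M ih =>
    obtain ⟨hM, hM'⟩ := ih d
    cases hvM : M.isVal <;>
      simp_all [Tm.lift, Lam.lift, cps, Tm.isVal_lift, Lam.lift_lift]

theorem cps_lift (M : Tm) (d : Nat) : cps (M.lift d) = (cps M).lift d :=
  (cps_lift_and_cpsV_lift M d).1

theorem cpsV_lift {V : Tm} (hV : V.isVal = true) (d : Nat) :
    cpsV (V.lift d) = (cpsV V).lift d :=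
  (cps_lift_and_cpsV_lift V d).2 hV

theorem cps_subst_and_cpsV_subst (M : Tm) (x : Nat) {V : Tm} (hV : V.isVal = true) :
    cps (M.subst x V) = (cps M).subst x (cpsV V) ∧
      (M.isVal = true → cpsV (M.subst x V) = (cpsV M).subst x (cpsV V)) := by
  have comm := fun (M N : Lam) (x : Nat) => (Lam.lift_subst_of_ge M N (Nat.zero_le x)).symm
  induction M generalizing x V with
  | var n =>
    refine ⟨?_, fun _ => by grind [Tm.subst, Lam.subst, cpsV]⟩
    have hv : (Tm.subst (.var n) x V).isVal = true := by rw [Tm.isVal_subst _ _ hV]; rfl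
    rw [cps_of_isVal hv, cps_of_isVal (V := .var n) rfl]
    simp only [Lam.subst, comm]
    grind [Tm.subst, Lam.subst, cpsV]
  | lam M ih =>
    have h := (ih (x + 1) (V := V.lift 0) (by rwa [Tm.isVal_lift])).1
    rw [cpsV_lift hV] at h
    have hc : cpsV ((Tm.lam M).subst x V) = (cpsV (.lam M)).subst x (cpsV V) := by
      simp [Tm.subst, Lam.subst, cpsV, h]
    refine ⟨?_, fun _ => hc⟩
    rw [cps_of_isVal (V := (Tm.lam M).subst x V) rfl, cps_of_isVal (V := .lam M) rfl, hc]
    simp [Lam.subst, comm]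
  | freeze M ih => simp [Tm.subst, Lam.subst, cps, cpsV, comm, (ih x hV).1]
  | app M N ihM ihN =>
    obtain ⟨hM, hM'⟩ := ihM x hV
    obtain ⟨hN, hN'⟩ := ihN x hV
    cases hvM : M.isVal <;> cases hvN : N.isVal <;>
      simp_all [Tm.subst, Lam.subst, cps, Tm.isVal_subst]
  | thaw M ih =>
    obtain ⟨hM, hM'⟩ := ih x hV
    cases hvM : M.isVal <;> simp_all [Tm.subst, Lam.subst, cps, Tm.isVal_subst]

theorem cps_subst (M : Tm) (x : Nat) {V : Tm} (hV : V.isVal = true) :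
    cps (M.subst x V) = (cps M).subst x (cpsV V) :=
  (cps_subst_and_cpsV_subst M x hV).1

/-- The term `λk. P (λx. B k)`, where `x` is the de Bruijn variable `0` of `B`. -/
def cpsLet (P B : Lam) : Lam :=
  .lam (.app (P.lift 0) (.lam (.app (B.lift 1) (.var 1))))

theorem cpsLet_steps {P P' B B' : Lam} (hP : Lam.Steps P P') (hB : Lam.Steps B B') :
    Lam.Steps (cpsLet P B) (cpsLet P' B') :=
  .lam (.app (hP.lift 0) (.lam (.app (hB.lift 1) (.refl _))))

theorem cps_plug {J : JCtx} {P : Tm} (hJ : J.Wf) (hP : P.isVal = false) :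
    cps (J.plug P) = cpsLet (cps P) (cps ((J.lift 0).plug (.var 0))) := by
  have comm := fun M : Lam => Lam.lift_lift M (Nat.le_refl 0)
  have comm1 := fun M : Lam => Lam.lift_lift M (Nat.zero_le 1)
  simp only [Nat.zero_add] at comm
  simp only [Nat.reduceAdd] at comm1
  cases J with
  | appL N =>
    cases hN : N.isVal <;>
      simp [JCtx.plug, JCtx.lift, cpsLet, cps, cpsV, hP, hN, Tm.isVal_lift, Lam.lift,
        cps_lift, cpsV_lift, comm, comm1]
  | appR V =>
    have hV : V.isVal = true := Tm.isVal_iff.2 hJ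
    simp [JCtx.plug, JCtx.lift, cpsLet, cps, cpsV, hP, hV, Tm.isVal_lift, Lam.lift,
      cpsV_lift, comm]
  | thaw => simp [JCtx.plug, JCtx.lift, cpsLet, cps, cpsV, hP, Lam.lift]

theorem subst_plug_lift (J : JCtx) (V : Tm) :
    ((J.lift 0).plug (.var 0)).subst 0 V = J.plug V := by
  cases J <;> simp [JCtx.lift, JCtx.plug, Tm.subst, Tm.subst_lift_self]

theorem cpsLet_steps_cps_plug {J : JCtx} (hJ : J.Wf) (M : Tm) :
    Lam.Steps (cpsLet (cps M) (cps ((J.lift 0).plug (.var 0)))) (cps (J.plug M)) := by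
  cases hM : M.isVal with
  | false => exact .of_eq (cps_plug hJ hM).symm
  | true =>
    rw [← subst_plug_lift J M, cps_subst _ _ hM, cps_of_isVal hM]
    generalize cps ((J.lift 0).plug (.var 0)) = B
    refine .trans (.lam ?_) (.eta _)
    simp only [Lam.lift]
    refine .trans (.beta _ _) ?_
    simp only [Lam.subst]
    refine .trans (.beta _ _) (.of_eq ?_)
    rw [Lam.lift_subst_of_le _ _ (Nat.le_refl 0), Lam.lift_lift _ (Nat.le_refl 0)]
    simp [Lam.subst, Lam.subst_lift_self]

/-- Reduction of the CPS images, including the value parts when `M` is a value. -/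
structure CpsSteps (M N : Tm) : Prop where
  cps : Lam.Steps (cps M) (cps N)
  isVal : M.isVal = true → N.isVal = true
  cpsV : M.isVal = true → Lam.Steps (cpsV M) (cpsV N)

namespace CpsSteps

theorem of_isVal {M N : Tm} (hM : M.isVal = true) (hN : N.isVal = true)
    (h : Lam.Steps (Shift0.cpsV M) (Shift0.cpsV N)) : CpsSteps M N where
  cps := by
    rw [cps_of_isVal hM, cps_of_isVal hN]
    exact .lam (.app (.refl _) (h.lift 0))
  isVal := fun _ => hN
  cpsV := fun _ => h

theorem of_not_isVal {M N : Tm} (hM : M.isVal = false)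
    (h : Lam.Steps (Shift0.cps M) (Shift0.cps N)) : CpsSteps M N where
  cps := h
  isVal := by simp [hM]
  cpsV := by simp [hM]

theorem lift {M N : Tm} (h : CpsSteps M N) (d : Nat) : CpsSteps (M.lift d) (N.lift d) where
  cps := by simpa only [cps_lift] using h.cps.lift d
  isVal := by simpa only [Tm.isVal_lift] using h.isVal
  cpsV := fun hM => by
    rw [Tm.isVal_lift] at hM
    rw [cpsV_lift hM, cpsV_lift (h.isVal hM)]
    exact (h.cpsV hM).lift d

theorem plug {M N : Tm} (h : CpsSteps M N) {J : JCtx} (hJ : J.Wf) (hM : M.isVal = false) :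
    Lam.Steps (Shift0.cps (J.plug M)) (Shift0.cps (J.plug N)) := by
  rw [cps_plug hJ hM]
  exact .trans (cpsLet_steps h.cps (.refl _)) (cpsLet_steps_cps_plug hJ N)

theorem appR_of_isVal {M N V : Tm} (h : CpsSteps M N) (hV : V.isVal = true) :
    Lam.Steps (Shift0.cps (.app V M)) (Shift0.cps (.app V N)) := by
  cases hM : M.isVal with
  | false => exact h.plug (J := .appR V) (Tm.isVal_iff.1 hV) hM
  | true =>
    simp only [Shift0.cps, hV, hM, h.isVal hM, if_true]
    exact .app (.refl _) (h.cpsV hM)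

theorem appR {M N : Tm} (h : CpsSteps M N) (L : Tm) : CpsSteps (.app L M) (.app L N) := by
  refine .of_not_isVal rfl ?_
  cases hL : L.isVal with
  | true => exact h.appR_of_isVal hL
  | false =>
    rw [show Tm.app L M = JCtx.plug (.appL M) L from rfl,
      show Tm.app L N = JCtx.plug (.appL N) L from rfl,
      cps_plug (J := .appL M) trivial hL, cps_plug (J := .appL N) trivial hL]
    exact cpsLet_steps (.refl _) ((h.lift 0).appR_of_isVal (V := .var 0) rfl)

theorem appL {M N : Tm} (h : CpsSteps M N) (L : Tm) : CpsSteps (.app M L) (.app N L) := by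
  refine .of_not_isVal rfl ?_
  cases hM : M.isVal with
  | false => exact h.plug (J := .appL L) trivial hM
  | true =>
    have hN := h.isVal hM
    have hc := h.cpsV hM
    cases hL : L.isVal with
    | true =>
      simp only [Shift0.cps, hL, hM, hN, if_true]
      exact .app hc (.refl _)
    | false =>
      simp only [Shift0.cps, hL, hM, hN, if_true, Bool.false_eq_true, if_false]
      exact .lam (.app (.refl _)
        (.lam (.app (.app ((hc.lift 0).lift 0) (.refl _)) (.refl _))))

theorem thaw {M N : Tm} (h : CpsSteps M N) : CpsSteps (.thaw M) (.thaw N) := by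
  refine .of_not_isVal rfl ?_
  cases hM : M.isVal with
  | false => exact h.plug (J := .thaw) trivial hM
  | true =>
    simp only [Shift0.cps, hM, h.isVal hM, if_true]
    exact h.cpsV hM

theorem of_contr {M N : Tm} (h : Tm.Contr M N) : CpsSteps M N := by
  cases h with
  | betav M V hV =>
    rw [← Tm.isVal_iff] at hV
    refine .of_not_isVal rfl ?_
    rw [cps_subst _ _ hV]
    simpa [Shift0.cps, Shift0.cpsV, hV] using .beta _ _
  | etav V hV =>
    rw [← Tm.isVal_iff] at hV
    refine .of_isVal rfl hV ?_
    simpa [Shift0.cps, Shift0.cpsV, hV, Tm.isVal_lift, cpsV_lift] using .eta _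
  | dolv V hV =>
    rw [← Tm.isVal_iff] at hV
    refine .of_isVal rfl rfl (.of_eq ?_)
    simp [Shift0.cps, Shift0.cpsV, hV, Tm.isVal_lift, cpsV_lift, cps_of_isVal]
  | dolsh V hV =>
    rw [← Tm.isVal_iff] at hV
    refine .of_isVal rfl hV (.of_eq ?_)
    simp [Shift0.cps, Shift0.cpsV, hV]
  | shdol M =>
    refine .of_not_isVal rfl (.of_eq ?_)
    simp [Shift0.cps, Shift0.cpsV]
  | pure V hV =>
    rw [← Tm.isVal_iff] at hV
    refine .of_not_isVal rfl (.of_eq ?_)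
    simp [Shift0.cps, Shift0.cpsV, hV, Tm.isVal_lift, cpsV_lift, cps_of_isVal]
  | bind J P hJ hP =>
    have hv : (J.plug P).isVal = false := by cases J <;> rfl
    refine .of_not_isVal hv (.of_eq ?_)
    rw [cps_plug hJ hP.isVal_eq_false]
    simp [Tm.letIn, Tm.dol, cpsLet, Shift0.cps, Shift0.cpsV, cps_lift]

theorem of_step {M N : Tm} (h : Tm.Step M N) : CpsSteps M N := by
  induction h with
  | contr h => exact of_contr h
  | lam _ ih =>
    refine .of_isVal rfl rfl ?_
    simpa only [Shift0.cpsV] using ih.cps.lam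
  | freeze _ ih =>
    refine .of_isVal rfl rfl ?_
    simpa only [Shift0.cpsV] using ih.cps
  | appL _ ih => exact ih.appL _
  | appR _ ih => exact ih.appR _
  | thaw _ ih => exact ih.thaw

end CpsSteps

theorem cps_steps {M N : Tm} (h : Tm.Steps M N) : Lam.Steps (cps M) (cps N) := by
  induction h with
  | refl => exact .refl _
  | tail _ h ih => exact ih.trans (CpsSteps.of_step h).cps

/-! ### The direct-style translation -/

theorem ds_lam_app_var_lift (L : Lam) :
    ds (.lam (.app (.var 0) (L.lift 0))) = nat L := by
  simp [ds, Lam.hasVar_lift, Lam.lower_lift]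

theorem ds_lam {M : Lam} (h : ∀ L : Lam, M ≠ .app (.var 0) (L.lift 0)) :
    ds (.lam M) = .thaw (.lam (ds M)) := by
  by_cases h' : ∃ L, M = .app (.var 0) L
  · obtain ⟨L, rfl⟩ := h'
    have hL : L.hasVar 0 = true := by
      by_contra hL
      exact h (L.lower 0) (by rw [Lam.lift_lower (by simpa using hL)])
    simp [ds, nat, hL]
  · rw [ds]
    intro L hL
    exact h' ⟨L, hL⟩

theorem eq_app_var_lift_or_ds_lam (M : Lam) :
    (∃ L : Lam, M = .app (.var 0) (L.lift 0)) ∨ ds (.lam M) = .thaw (.lam (ds M)) := by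
  by_cases h : ∃ L : Lam, M = .app (.var 0) (L.lift 0)
  · exact .inl h
  · exact .inr (ds_lam fun L hL => h ⟨L, hL⟩)

theorem isVal_nat (M : Lam) : (nat M).isVal = true := by
  cases M <;> simp [nat]

theorem isValue_nat (M : Lam) : (nat M).IsValue := Tm.isVal_iff.1 (isVal_nat M)

/-- Induction along the recursion of the direct-style translation. -/
theorem dsInduction {p : Lam → Prop} (var : ∀ n, p (.var n))
    (app : ∀ M N, p M → p N → p (.app M N))
    (lamVar : ∀ L, p L → p (.app (.var 0) (L.lift 0)) → p (.lam (.app (.var 0) (L.lift 0))))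
    (lam : ∀ M, (∀ L : Lam, M ≠ .app (.var 0) (L.lift 0)) → p M → p (.lam M)) (M : Lam) :
    p M := by
  induction hn : M.size using Nat.strong_induction_on generalizing M with
  | _ n ih =>
    subst hn
    cases M with
    | var n => exact var n
    | app M N =>
      exact app _ _ (ih _ (by simp [Lam.size]) _ rfl) (ih _ (by simp [Lam.size]) _ rfl)
    | lam M =>
      by_cases h : ∃ L : Lam, M = .app (.var 0) (L.lift 0)
      · obtain ⟨L, rfl⟩ := h
        exact lamVar L (ih _ (by simp [Lam.size, Lam.size_lift]; omega) _ rfl)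
          (ih _ (by simp [Lam.size]) _ rfl)
      · exact lam M (fun L hL => h ⟨L, hL⟩) (ih _ (by simp [Lam.size]) _ rfl)

theorem cps_ds_and_cpsV_nat (N : Lam) : cps (ds N) = N ∧ cpsV (nat N) = N := by
  induction N using dsInduction with
  | var n => simp [ds, nat, cps, cpsV]
  | app M N ihM ihN => simp [ds, nat, cps, cpsV, isVal_nat, ihM, ihN]
  | lamVar L ih ih' =>
    rw [ds_lam_app_var_lift, nat, cps_of_isVal (isVal_nat L), cpsV, ih.2, ih'.1]
    exact ⟨rfl, rfl⟩
  | lam M h ih =>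
    rw [ds_lam h, nat]
    simp [cps, cpsV, ih]

theorem cps_ds (N : Lam) : cps (ds N) = N := (cps_ds_and_cpsV_nat N).1

theorem ds_lift_and_nat_lift (M : Lam) (d : Nat) :
    ds (M.lift d) = (ds M).lift d ∧ nat (M.lift d) = (nat M).lift d := by
  induction M using dsInduction generalizing d with
  | var n => simp only [Lam.lift]; split <;> simp [ds, nat, Tm.lift, *]
  | app M N ihM ihN => simp [Lam.lift, ds, nat, Tm.lift, ihM, ihN]
  | lamVar L ih ih' =>
    refine ⟨?_, ?_⟩
    · rw [ds_lam_app_var_lift, ← (ih d).2, ← ds_lam_app_var_lift]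
      simp [Lam.lift, Lam.lift_lift]
    · rw [nat, Tm.lift, ← (ih' (d + 1)).1, Lam.lift, nat]
  | lam M h ih =>
    refine ⟨?_, ?_⟩
    · rw [Lam.lift, ds_lam h, ds_lam, (ih _).1, Tm.lift, Tm.lift]
      intro L hL
      cases M with
      | var n => grind [Lam.lift]
      | lam M => simp [Lam.lift] at hL
      | app M N =>
        simp only [Lam.lift, Lam.app.injEq] at hL
        obtain ⟨B, rfl, -⟩ := Lam.exists_lift_of_lift_eq_lift _ _ (Nat.zero_le d) hL.2
        exact h B (by rw [Lam.lift_eq_var_zero hL.1])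
    · rw [Lam.lift, nat, nat, (ih _).1, Tm.lift]

theorem nat_lift (M : Lam) (d : Nat) : nat (M.lift d) = (nat M).lift d :=
  (ds_lift_and_nat_lift M d).2

theorem thaw_nat_steps_ds (M : Lam) : Tm.Steps (.thaw (nat M)) (ds M) := by
  cases M with
  | var n => simpa only [ds, nat] using .refl _
  | app M N => simpa only [ds, nat] using .contr (.shdol _)
  | lam M =>
    rcases eq_app_var_lift_or_ds_lam M with ⟨L, rfl⟩ | h
    · simp only [ds_lam_app_var_lift, nat, ds, nat_lift]
      exact .contr (.pure _ (isValue_nat L))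
    · rw [h, nat]
      exact .refl _

theorem freeze_ds_steps_nat (M : Lam) : Tm.Steps (.freeze (ds M)) (nat M) := by
  cases M with
  | var n => simpa only [ds, nat] using .contr (.dolsh _ (.var n))
  | app M N => simpa only [ds, nat] using .refl _
  | lam M =>
    rcases eq_app_var_lift_or_ds_lam M with ⟨L, rfl⟩ | h
    · simp only [ds_lam_app_var_lift, nat, ds, nat_lift]
      exact .contr (.dolv _ (isValue_nat L))
    · rw [h, nat]
      exact .contr (.dolsh _ (.lam _))

theorem ds_subst_and_nat_subst (M N : Lam) (x : Nat) :
    Tm.Steps ((ds M).subst x (nat N)) (ds (M.subst x N)) ∧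
      Tm.Steps ((nat M).subst x (nat N)) (nat (M.subst x N)) := by
  induction M using dsInduction generalizing x N with
  | var n =>
    have h : (Tm.var n).subst x (nat N) = nat ((Lam.var n).subst x N) := by
      simp only [Tm.subst, Lam.subst]
      split_ifs <;> simp [nat]
    simp only [ds, nat, h]
    rw [Tm.subst, h]
    exact ⟨thaw_nat_steps_ds _, .refl _⟩
  | app M L ihM ihL =>
    simp only [ds, nat, Lam.subst, Tm.subst]
    exact ⟨.app (ihM N x).2 (ihL N x).2, .freeze (.app (ihM N x).2 (ihL N x).2)⟩
  | lamVar L ih ih' =>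
    refine ⟨?_, ?_⟩
    · rw [ds_lam_app_var_lift]
      simp only [Lam.subst, ← Lam.lift_subst_of_ge L N (Nat.zero_le x)]
      simpa [ds_lam_app_var_lift] using (ih N x).2
    · rw [nat, Lam.subst, nat, Tm.subst, ← nat_lift]
      exact .lam (ih' _ _).1
  | lam M h ih =>
    have h' : Tm.Steps ((nat (.lam M)).subst x (nat N)) (nat ((Lam.lam M).subst x N)) := by
      rw [nat, Lam.subst, nat, Tm.subst, ← nat_lift]
      exact .lam (ih _ _).1
    refine ⟨?_, h'⟩
    rw [ds_lam h, ← nat, Tm.subst]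
    exact h'.thaw.trans (thaw_nat_steps_ds _)

theorem ds_step_and_nat_step {M N : Lam} (h : Lam.Step M N) :
    Tm.Steps (ds M) (ds N) ∧ Tm.Steps (nat M) (nat N) := by
  induction hn : M.size using Nat.strong_induction_on generalizing M N with
  | _ n ih =>
    subst hn
    cases h with
    | contr h =>
      cases h with
      | beta M N =>
        have h : Tm.Steps (ds (.app (.lam M) N)) (ds (M.subst 0 N)) := by
          simp only [ds, nat]
          exact .trans (.contr (.betav _ _ (isValue_nat N))) (ds_subst_and_nat_subst M N 0).1
        refine ⟨h, ?_⟩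
        rw [nat, ← ds]
        exact h.freeze.trans (freeze_ds_steps_nat _)
      | eta =>
        have h : Tm.Steps (nat (.lam (.app (N.lift 0) (.var 0)))) (nat N) := by
          simp only [ds, nat, nat_lift]
          exact .contr (.etav _ (isValue_nat N))
        refine ⟨?_, h⟩
        rw [ds_lam (by intro L; simp [Lam.lift_zero_ne_var_zero]), ← nat]
        exact h.thaw.trans (thaw_nat_steps_ds _)
    | @lam M N h =>
      have h' : Tm.Steps (nat (.lam M)) (nat (.lam N)) := by
        simp only [nat]
        exact .lam (ih _ (by simp [Lam.size]) h rfl).1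
      refine ⟨?_, h'⟩
      rcases eq_app_var_lift_or_ds_lam M with ⟨L, rfl⟩ | hM
      · cases h with
        | contr h => cases h
        | appL h => cases h with | contr h => cases h
        | appR h =>
          obtain ⟨L', rfl, hL⟩ := h.exists_of_lift
          simp only [ds_lam_app_var_lift]
          exact (ih _ (by simp [Lam.size, Lam.size_lift]; omega) hL rfl).2
      · rw [hM, ← nat]
        exact h'.thaw.trans (thaw_nat_steps_ds _)
    | @appL M N L h =>
      have hM := (ih _ (by simp [Lam.size]) h rfl).2
      simp only [ds, nat]
      exact ⟨.app hM (.refl _), .freeze (.app hM (.refl _))⟩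
    | @appR M N L h =>
      have hM := (ih _ (by simp [Lam.size]) h rfl).2
      simp only [ds, nat]
      exact ⟨.app (.refl _) hM, .freeze (.app (.refl _) hM)⟩

theorem ds_steps {M N : Lam} (h : Lam.Steps M N) : Tm.Steps (ds M) (ds N) := by
  induction h with
  | refl => exact .refl _
  | tail _ h ih => exact ih.trans (ds_step_and_nat_step h).1

/-! ### The unit of the connection -/

theorem ds_cpsLet (P B : Lam) :
    ds (cpsLet P B) = .thaw (.lam (.app (nat (P.lift 0))
      (.lam (.app (nat (B.lift 1)) (.var 1))))) := by
  rw [cpsLet, ds_lam (by intro L; simp [Lam.lift_zero_ne_var_zero])]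
  simp only [ds, nat]

theorem plug_steps_ds_cps {J : JCtx} {P : Tm} (hJ : J.Wf) (hP : P.isVal = false)
    (ihP : Tm.Steps (P.lift 0) (ds (cps (P.lift 0))))
    (ihJ : Tm.Steps (((J.lift 0).plug (.var 0)).lift 1)
      (ds (cps (((J.lift 0).plug (.var 0)).lift 1)))) :
    Tm.Steps (J.plug P) (ds (cps (J.plug P))) := by
  refine .trans (.contr (.bind J P hJ (Tm.isNonvalue_of_isVal_eq_false hP))) ?_
  rw [cps_plug hJ hP, ds_cpsLet, ← cps_lift, ← cps_lift]
  exact .thaw (.lam (.app (.trans (.freeze ihP) (freeze_ds_steps_nat _))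
    (.lam (.app (.trans (.freeze ihJ) (freeze_ds_steps_nat _)) (.refl _)))))

theorem ds_cps_of_isVal {V : Tm} (hV : V.isVal = true) : ds (cps V) = nat (cpsV V) := by
  rw [cps_of_isVal hV, ds_lam_app_var_lift]

theorem steps_ds_cps (M : Tm) : Tm.Steps M (ds (cps M)) := by
  induction hn : M.size using Nat.strong_induction_on generalizing M with
  | _ n ih =>
    subst hn
    have ihV : ∀ V : Tm, V.size < M.size → V.isVal = true → Tm.Steps V (nat (cpsV V)) :=
      fun V h hV => ds_cps_of_isVal hV ▸ ih _ h V rfl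
    cases M with
    | var n =>
      rw [ds_cps_of_isVal rfl, cpsV, nat]
      exact .refl _
    | lam M =>
      rw [ds_cps_of_isVal rfl, cpsV, nat]
      exact .lam (ih _ (by simp [Tm.size]) M rfl)
    | freeze M =>
      rw [ds_cps_of_isVal rfl, cpsV]
      exact .trans (.freeze (ih _ (by simp [Tm.size]) M rfl)) (freeze_ds_steps_nat _)
    | thaw M =>
      cases hM : M.isVal with
      | true =>
        simp only [cps, hM, if_true]
        exact .trans (.thaw (ihV M (by simp [Tm.size]) hM)) (thaw_nat_steps_ds _)
      | false =>
        have hs := (Tm.isNonvalue_of_isVal_eq_false hM).one_lt_size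
        refine plug_steps_ds_cps (J := .thaw) trivial hM (ih _ ?_ _ rfl) (ih _ ?_ _ rfl) <;>
          simp only [Tm.size_lift, Tm.size, JCtx.plug, JCtx.lift] <;> omega
    | app M N =>
      cases hM : M.isVal with
      | false =>
        have hs := (Tm.isNonvalue_of_isVal_eq_false hM).one_lt_size
        refine plug_steps_ds_cps (J := .appL N) trivial hM (ih _ ?_ _ rfl) (ih _ ?_ _ rfl) <;>
          simp only [Tm.size_lift, Tm.size, JCtx.plug, JCtx.lift] <;> omega
      | true =>
        cases hN : N.isVal with
        | false =>
          have hs := (Tm.isNonvalue_of_isVal_eq_false hN).one_lt_size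
          refine plug_steps_ds_cps (J := .appR M) (Tm.isVal_iff.1 hM) hN
            (ih _ ?_ _ rfl) (ih _ ?_ _ rfl) <;>
            simp only [Tm.size_lift, Tm.size, JCtx.plug, JCtx.lift] <;> omega
        | true =>
          simp only [cps, hM, hN, if_true, ds]
          exact .app (ihV M (by simp [Tm.size]) hM) (ihV N (by simp [Tm.size]) hN)

/-- **Galois connection / reflection.**  For every Λ$-term `M` and λ-term `N`,
`M ↠Λ$ N#` iff `M* ↠λ N`; together with the right inverse property
`N^{#*} ≡ N`, the pair `(*, #)` is a reflection of `λ` into `Λ$`. -/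
theorem cps_ds_reflection (M : Tm) (N : Lam) :
    (Tm.Steps M (ds N) ↔ Lam.Steps (cps M) N) ∧ cps (ds N) = N :=
  ⟨⟨fun h => by simpa only [cps_ds] using cps_steps h,
    fun h => (steps_ds_cps M).trans (ds_steps h)⟩, cps_ds N⟩

end Shift0
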